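/- Let H be a Hilbert space, (A_ν)_{ν≥0} a family of generators of contraction semigroups on H such that ν ↦ e^{τA_ν}W is continuous from [0,∞) to H for each fixed τ ≥ 0 and W ∈ H, and let C be a compact operator on H. Set L_ν = A_ν + C. If there exist λ₀ ∈ ℂ with Re λ₀ > 0 and W₀ ∈ D(L₀) with L₀W₀ = λ₀W₀, then for every ν₀ > 0 there exist ν ∈ (0, ν₀], λ_ν ∈ ℂ with Re λ_ν > Re λ₀/2, and W_ν ∈ D(L_ν) with L_ν W_ν = λ_ν W_ν. -/

import Mathlib

noncomputable section

open Filter Set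

variable {H : Type*} [NormedAddCommGroup H] [InnerProductSpace ℂ H] [CompleteSpace H]

/-- A strongly continuous (C₀) semigroup of bounded operators. -/
def IsC0Semigroup (T : ℝ → H →L[ℂ] H) : Prop :=
  T 0 = ContinuousLinearMap.id ℂ H ∧
    (∀ s t : ℝ, 0 ≤ s → 0 ≤ t → T (s + t) = (T s).comp (T t)) ∧
    ∀ x : H, ContinuousOn (fun t => T t x) (Set.Ici 0)

/-- A contraction semigroup: a C₀-semigroup with `‖T t‖ ≤ 1` for all `t ≥ 0`. -/
def IsContractionSemigroup (T : ℝ → H →L[ℂ] H) : Prop :=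
  IsC0Semigroup T ∧ ∀ t : ℝ, 0 ≤ t → ‖T t‖ ≤ 1

/-- `A`, an (unbounded) operator with domain `D`, generates the semigroup `T`. -/
def Generates (A : H → H) (D : Set H) (T : ℝ → H →L[ℂ] H) : Prop :=
  IsC0Semigroup T ∧
    (∀ x : H, x ∈ D ↔
      ∃ y : H, Tendsto (fun t : ℝ => t⁻¹ • (T t x - x)) (nhdsWithin 0 (Set.Ioi 0)) (nhds y)) ∧
    ∀ x ∈ D, Tendsto (fun t : ℝ => t⁻¹ • (T t x - x)) (nhdsWithin 0 (Set.Ioi 0)) (nhds (A x))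

set_option linter.unusedSectionVars false

open MeasureTheory in
/-- The Laplace transform of the orbit of `x`. -/
def laplaceOrbit (T : ℝ → H →L[ℂ] H) (z : ℂ) (x : H) : H :=
  ∫ τ in Ioi (0 : ℝ), Complex.exp (-z * τ) • T τ x

section Laplace

open MeasureTheory

variable {T : ℝ → H →L[ℂ] H}

lemma IsContractionSemigroup.continuousOn_integrand (hT : IsContractionSemigroup T)
    (z : ℂ) (x : H) :
    ContinuousOn (fun τ : ℝ => Complex.exp (-z * τ) • T τ x) (Ici 0) :=
  ContinuousOn.smul (by fun_prop) (hT.1.2.2 x)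

lemma IsContractionSemigroup.norm_integrand_le (hT : IsContractionSemigroup T)
    (z : ℂ) (x : H) {τ : ℝ} (hτ : 0 ≤ τ) :
    ‖Complex.exp (-z * τ) • T τ x‖ ≤ Real.exp (-z.re * τ) * ‖x‖ := by
  rw [norm_smul, Complex.norm_exp]
  have h := (T τ).le_of_opNorm_le (hT.2 τ hτ) x
  rw [one_mul] at h
  simp only [Complex.mul_re, Complex.neg_re, Complex.ofReal_re, Complex.neg_im, Complex.ofReal_im,
    mul_zero, sub_zero]
  gcongr

lemma IsContractionSemigroup.aestronglyMeasurable_integrand (hT : IsContractionSemigroup T)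
    (z : ℂ) (x : H) :
    AEStronglyMeasurable (fun τ : ℝ => Complex.exp (-z * τ) • T τ x)
      (volume.restrict (Ioi 0)) :=
  ((hT.continuousOn_integrand z x).mono Ioi_subset_Ici_self).aestronglyMeasurable
    measurableSet_Ioi

lemma IsContractionSemigroup.integrableOn_integrand (hT : IsContractionSemigroup T)
    {z : ℂ} (hz : 0 < z.re) (x : H) :
    IntegrableOn (fun τ : ℝ => Complex.exp (-z * τ) • T τ x) (Ioi 0) := by
  refine Integrable.mono' ((integrableOn_exp_mul_Ioi (a := -z.re) (by linarith) 0).mul_const ‖x‖)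
    (hT.aestronglyMeasurable_integrand z x) ?_
  filter_upwards [ae_restrict_mem measurableSet_Ioi] with τ hτ
  exact hT.norm_integrand_le z x (le_of_lt hτ)

lemma IsContractionSemigroup.norm_laplaceOrbit_le (hT : IsContractionSemigroup T)
    {z : ℂ} (hz : 0 < z.re) (x : H) :
    ‖laplaceOrbit T z x‖ ≤ 1 / z.re * ‖x‖ := by
  have hz' : -z.re < 0 := by linarith
  calc ‖laplaceOrbit T z x‖ ≤ ∫ τ in Ioi (0 : ℝ), Real.exp (-z.re * τ) * ‖x‖ := by
        refine norm_integral_le_of_norm_le ((integrableOn_exp_mul_Ioi hz' 0).mul_const ‖x‖) ?_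
        filter_upwards [ae_restrict_mem measurableSet_Ioi] with τ hτ
        exact hT.norm_integrand_le z x (le_of_lt hτ)
    _ = 1 / z.re * ‖x‖ := by
        rw [integral_mul_const, integral_exp_mul_Ioi hz']
        simp

/-- A contraction semigroup has, on the right half-plane, a bounded Laplace transform. -/
lemma IsContractionSemigroup.exists_laplaceOrbit_eq (hT : IsContractionSemigroup T) :
    ∃ R : ℂ → H →L[ℂ] H, ∀ z : ℂ, 0 < z.re →
      ‖R z‖ ≤ 1 / z.re ∧ ∀ x, R z x = laplaceOrbit T z x := by
  have h : ∀ z : ℂ, ∃ R : H →L[ℂ] H, 0 < z.re →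
      ‖R‖ ≤ 1 / z.re ∧ ∀ x, R x = laplaceOrbit T z x := by
    intro z
    by_cases hz : 0 < z.re
    · let L : H →ₗ[ℂ] H :=
        { toFun := laplaceOrbit T z
          map_add' := fun x y => by
            simp only [laplaceOrbit, map_add, smul_add]
            exact integral_add (hT.integrableOn_integrand hz x) (hT.integrableOn_integrand hz y)
          map_smul' := fun c x => by
            simp only [laplaceOrbit, map_smul, smul_comm _ c, RingHom.id_apply]
            exact integral_smul c _ }
      exact ⟨L.mkContinuous (1 / z.re) (hT.norm_laplaceOrbit_le hz), fun _ =>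
        ⟨L.mkContinuous_norm_le (by positivity) _, fun _ => rfl⟩⟩
    · exact ⟨0, fun h => absurd h hz⟩
  choose R hR using h
  exact ⟨R, hR⟩

/-- How the semigroup acts on the Laplace transform of an orbit. -/
lemma IsContractionSemigroup.apply_laplaceOrbit (hT : IsContractionSemigroup T)
    {z : ℂ} (hz : 0 < z.re) (x : H) {h : ℝ} (hh : 0 ≤ h) :
    T h (laplaceOrbit T z x) = Complex.exp (z * h) •
      (laplaceOrbit T z x - ∫ τ in (0 : ℝ)..h, Complex.exp (-z * τ) • T τ x) := by
  have hint := hT.integrableOn_integrand hz x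
  rw [laplaceOrbit, ← intervalIntegral.integral_Ioi_sub_Ioi hint hh, sub_sub_cancel,
    ← (T h).integral_comp_comm hint, ← integral_smul]
  have hpre := (measurePreserving_add_right volume h).setIntegral_preimage_emb
    (measurableEmbedding_addRight h)
    (fun τ : ℝ => Complex.exp (z * h) • Complex.exp (-z * τ) • T τ x) (Ioi h)
  have hset : (fun t : ℝ => t + h) ⁻¹' Ioi h = Ioi 0 := by
    ext t; simp
  rw [← hpre, hset]
  refine setIntegral_congr_fun measurableSet_Ioi fun τ hτ => ?_
  rw [add_comm τ h, hT.1.2.1 h τ hh (le_of_lt hτ), map_smul, smul_smul, ← Complex.exp_add]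
  congr 2
  push_cast
  ring

lemma IsContractionSemigroup.tendsto_laplaceOrbit (hT : IsContractionSemigroup T)
    {z : ℂ} (hz : 0 < z.re) (x : H) :
    Tendsto (fun t : ℝ => t⁻¹ • (T t (laplaceOrbit T z x) - laplaceOrbit T z x))
      (nhdsWithin 0 (Ioi 0)) (nhds (z • laplaceOrbit T z x - x)) := by
  have hcont := hT.continuousOn_integrand z x
  have hI : HasDerivWithinAt
      (fun h : ℝ => ∫ τ in (0 : ℝ)..h, Complex.exp (-z * τ) • T τ x) x (Ici 0) 0 := by
    have := intervalIntegral.integral_hasDerivWithinAt_right (a := 0) (b := 0) (s := Ici 0)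
      (t := Ioi 0)
      IntervalIntegrable.refl
      ((hcont.mono Ioi_subset_Ici_self).stronglyMeasurableAtFilter_nhdsWithin measurableSet_Ioi 0)
      ((hcont 0 self_mem_Ici).mono Ioi_subset_Ici_self)
    simpa [hT.1.1] using this
  have hE : HasDerivWithinAt (fun h : ℝ => Complex.exp (z * h)) z (Ici 0) 0 := by
    have : HasDerivAt (fun h : ℝ => Complex.exp (z * h)) (Complex.exp (z * (0 : ℝ)) * (z * 1)) 0 :=
      ((Complex.ofRealCLM.hasDerivAt (x := (0 : ℝ))).const_mul z).cexp
    simpa using this.hasDerivWithinAt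
  have hg := hE.smul ((hasDerivWithinAt_const (0 : ℝ) (Ici 0) (laplaceOrbit T z x)).sub hI)
  have hg' := (hasDerivWithinAt_iff_tendsto_slope' (lt_irrefl 0)).1 (hg.mono Ioi_subset_Ici_self)
  refine Tendsto.congr' ?_ (hg'.trans_eq ?_)
  · filter_upwards [self_mem_nhdsWithin] with t ht
    rw [hT.apply_laplaceOrbit hz x (le_of_lt ht)]
    simp [slope, vsub_eq_sub]
  · simp [sub_eq_neg_add]

lemma Generates.resolvent_mem_and_apply {A : H → H} {D : Set H} (hG : Generates A D T)
    (hT : IsContractionSemigroup T) {z : ℂ} (hz : 0 < z.re) (x : H) :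
    laplaceOrbit T z x ∈ D ∧ A (laplaceOrbit T z x) = z • laplaceOrbit T z x - x := by
  have h := hT.tendsto_laplaceOrbit hz x
  have hD := (hG.2.1 _).2 ⟨_, h⟩
  exact ⟨hD, tendsto_nhds_unique (hG.2.2 _ hD) h⟩

lemma Generates.laplaceOrbit_sub {A : H → H} {D : Set H} (hG : Generates A D T)
    (hT : IsContractionSemigroup T) {z : ℂ} (hz : 0 < z.re) {x : H} (hx : x ∈ D) :
    laplaceOrbit T z (z • x - A x) = x := by
  obtain ⟨R₀, hR₀⟩ := hT.exists_laplaceOrbit_eq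
  obtain ⟨R, hR⟩ : ∃ R : H →L[ℂ] H, ∀ x, R x = laplaceOrbit T z x := ⟨R₀ z, (hR₀ z hz).2⟩
  have hcomm : ∀ t, 0 ≤ t → R (T t x) = T t (R x) := by
    intro t ht
    rw [hR, hR, laplaceOrbit, laplaceOrbit,
      ← (T t).integral_comp_comm (hT.integrableOn_integrand hz x)]
    refine setIntegral_congr_fun measurableSet_Ioi fun τ hτ => ?_
    have h1 := congrArg (fun S => S x) (hT.1.2.1 t τ ht (le_of_lt hτ))
    have h2 := congrArg (fun S => S x) (hT.1.2.1 τ t (le_of_lt hτ) ht)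
    rw [add_comm] at h2
    simp only [ContinuousLinearMap.comp_apply] at h1 h2
    simp only [map_smul, ← h1, ← h2]
  have h1 := (R.continuous.tendsto _).comp (hG.2.2 x hx)
  have h2 := hT.tendsto_laplaceOrbit hz x
  rw [← hR] at h2
  have h3 : R (A x) = z • R x - x := by
    refine tendsto_nhds_unique (h1.congr' ?_) h2
    filter_upwards [self_mem_nhdsWithin] with t ht
    simp only [Function.comp_apply, ← hcomm t (le_of_lt ht)]
    rw [← Complex.coe_smul, map_smul, map_sub, Complex.coe_smul]
  rw [← hR, map_sub, map_smul, h3, sub_sub_cancel]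

end Laplace

/-- **Hurwitz's theorem** for a jointly continuous family of holomorphic functions. -/
lemma exists_zero_of_continuousOn_family {d : ℝ → ℂ → ℂ} {U : Set ℂ} (hU : IsOpen U)
    (hUc : IsPreconnected U)
    (hcont : ContinuousOn (fun p : ℝ × ℂ => d p.1 p.2) (Ici 0 ×ˢ U))
    (hdiff : ∀ ν, 0 ≤ ν → DifferentiableOn ℂ (d ν) U)
    {z₀ z₁ : ℂ} (hz₀ : z₀ ∈ U) (hz₁ : z₁ ∈ U) (h₀ : d 0 z₀ = 0) (h₁ : d 0 z₁ ≠ 0)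
    {ν₀ : ℝ} (hν₀ : 0 < ν₀) :
    ∃ ν, 0 < ν ∧ ν ≤ ν₀ ∧ ∃ z ∈ U, d ν z = 0 := by
  by_contra! hne
  have han : AnalyticOnNhd ℂ (d 0) U := (hdiff 0 le_rfl).analyticOnNhd hU
  have hisol : ∀ᶠ z in nhdsWithin z₀ {z₀}ᶜ, d 0 z ≠ 0 := by
    refine ((han z₀ hz₀).eventually_eq_zero_or_eventually_ne_zero).resolve_left fun h => h₁ ?_
    exact han.eqOn_zero_of_preconnected_of_eventuallyEq_zero hUc hz₀ h hz₁
  obtain ⟨r, hr, hball⟩ : ∃ r > 0, Metric.closedBall z₀ r ⊆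
      {z | z ∈ U ∧ (z ∈ ({z₀}ᶜ : Set ℂ) → d 0 z ≠ 0)} :=
    Metric.nhds_basis_closedBall.mem_iff.1
      (Filter.inter_mem (hU.mem_nhds hz₀) (eventually_nhdsWithin_iff.1 hisol))
  have hsphere : ∀ z ∈ Metric.sphere z₀ r, z ∈ U ∧ d 0 z ≠ 0 := fun z hz =>
    ⟨(hball (Metric.sphere_subset_closedBall hz)).1,
      (hball (Metric.sphere_subset_closedBall hz)).2 (Metric.ne_of_mem_sphere hz hr.ne')⟩
  have hslice : ∀ ν, 0 ≤ ν → ContinuousOn (d ν) U := fun ν hν => (hdiff ν hν).continuousOn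
  obtain ⟨m, hm, hmle⟩ : ∃ m > 0, ∀ z ∈ Metric.sphere z₀ r, m < ‖d 0 z‖ := by
    obtain ⟨w, hw, hmin⟩ := (isCompact_sphere z₀ r).exists_isMinOn
      (NormedSpace.sphere_nonempty.2 hr.le)
      ((hslice 0 le_rfl).mono fun z hz => (hsphere z hz).1).norm
    have hpos : 0 < ‖d 0 w‖ := norm_pos_iff.2 (hsphere w hw).2
    exact ⟨‖d 0 w‖ / 2, by positivity, fun z hz => (half_lt_self hpos).trans_le (hmin hz)⟩
  have hlarge : ∀ᶠ ν in nhdsWithin (0 : ℝ) (Ici 0), ∀ z ∈ Metric.sphere z₀ r, m < ‖d ν z‖ := by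
    refine eventually_nhdsWithin_iff.2
      (((isCompact_sphere z₀ r).eventually_forall_of_forall_eventually
        (P := fun ν z => ν ∈ Ici (0 : ℝ) → m < ‖d ν z‖) fun z hz => ?_).mono
          fun ν h hν z hz => h z hz hν)
    have hzU := (hsphere z hz).1
    have h := (hcont (0, z) ⟨self_mem_Ici, hzU⟩).norm.eventually_const_lt (hmle z hz)
    filter_upwards [eventually_nhdsWithin_iff.1 h,
      continuous_snd.continuousAt.preimage_mem_nhds (hU.mem_nhds hzU)] with p hp hpU hp0
    exact hp ⟨hp0, hpU⟩
  have hsmall : ∀ᶠ ν in nhdsWithin (0 : ℝ) (Ici 0), ‖d ν z₀‖ < m := by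
    have h : ContinuousWithinAt (fun ν => d ν z₀) (Ici 0) 0 :=
      (hcont (0, z₀) ⟨self_mem_Ici, hz₀⟩).comp (f := fun ν : ℝ => (ν, z₀))
        (by fun_prop) fun ν hν => ⟨hν, hz₀⟩
    exact h.norm.eventually_lt_const (by simpa [h₀] using hm)
  obtain ⟨ν, ⟨hlν, hsν⟩, hν, hνle⟩ :=
    (((hlarge.and hsmall).filter_mono (nhdsWithin_mono 0 Ioi_subset_Ici_self)).and
      (Ioc_mem_nhdsGT hν₀)).exists
  have hsub : Metric.closedBall z₀ r ⊆ U := fun z hz => (hball hz).1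
  have hinv : DiffContOnCl ℂ (fun z => (d ν z)⁻¹) (Metric.ball z₀ r) := by
    refine DifferentiableOn.diffContOnCl ?_
    rw [closure_ball z₀ hr.ne']
    exact ((hdiff ν hν.le).mono hsub).inv fun z hz => hne ν hν hνle z (hsub hz)
  have hle := Complex.norm_le_of_forall_mem_frontier_norm_le Metric.isBounded_ball hinv
    (C := m⁻¹) (z := z₀) (fun z hz => by
      rw [frontier_ball z₀ hr.ne'] at hz
      rw [norm_inv]
      exact inv_anti₀ hm (hlν z hz).le) (subset_closure (Metric.mem_ball_self hr))
  rw [norm_inv] at hle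
  have hpos : 0 < ‖d ν z₀‖ := norm_pos_iff.2 (hne ν hν hνle z₀ hz₀)
  exact absurd ((inv_le_inv₀ hpos hm).1 hle) (not_le.2 hsν)

/-- A compact operator into a Hilbert space is a norm limit of finite rank operators. -/
lemma IsCompactOperator.exists_finiteRank_norm_sub_le {C : H →L[ℂ] H}
    (hC : IsCompactOperator (fun x => C x)) {ε : ℝ} (hε : 0 < ε) :
    ∃ (n : ℕ) (b : Fin n → H) (q : Fin n → H →L[ℂ] ℂ) (E : H →L[ℂ] H),
      ‖E‖ ≤ ε ∧ ∀ x, C x = E x + ∑ i, q i x • b i := by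
  have htb : TotallyBounded (C '' Metric.closedBall 0 1) :=
    (IsCompactOperator.isCompact_closure_image_closedBall
      (f := (C : H →ₗ[ℂ] H)) hC 1).totallyBounded.subset subset_closure
  obtain ⟨t, ht, hcover⟩ := Metric.totallyBounded_iff.1 htb ε hε
  let V : Submodule ℂ H := Submodule.span ℂ t
  have : FiniteDimensional ℂ V := FiniteDimensional.span_of_finite ℂ ht
  let b := stdOrthonormalBasis ℂ V
  refine ⟨Module.finrank ℂ V, fun i => (b i : H), fun i => (innerSL ℂ (b i : H)).comp C,
    C - V.starProjection.comp C, ?_, ?_⟩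
  · refine ContinuousLinearMap.opNorm_le_of_unit_norm hε.le fun x hx => ?_
    have hmem : C x ∈ C '' Metric.closedBall 0 1 := ⟨x, by simp [hx], rfl⟩
    obtain ⟨y, hy, hxy⟩ := mem_iUnion₂.1 (hcover hmem)
    change ‖C x - V.starProjection (C x)‖ ≤ ε
    rw [Submodule.starProjection_minimal]
    refine (ciInf_le ⟨0, ?_⟩ (⟨y, Submodule.subset_span hy⟩ : V)).trans ?_
    · rintro _ ⟨v, rfl⟩
      exact norm_nonneg _
    · rw [← dist_eq_norm]
      exact (Metric.mem_ball.1 hxy).le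
  · intro x
    have h := congrArg (fun P => P (C x)) b.starProjection_eq_sum_rankOne
    simp only [_root_.sum_apply, InnerProductSpace.rankOne_apply] at h
    simp [h]
/-- For `R` a resolvent and `E` a small perturbation, `R (1 - E R)⁻¹` is the perturbed resolvent. -/
def perturbedResolvent (E R : H →L[ℂ] H) : H →L[ℂ] H := R * Ring.inverse (1 - E * R)

section Perturbation

variable {E R : H →L[ℂ] H}

lemma isUnit_one_sub_mul (h : ‖E‖ * ‖R‖ < 1) : IsUnit (1 - E * R) :=
  isUnit_one_sub_of_norm_lt_one ((norm_mul_le _ _).trans_lt h)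

lemma perturbedResolvent_mul_one_sub (h : ‖E‖ * ‖R‖ < 1) :
    perturbedResolvent E R * (1 - E * R) = R := by
  rw [perturbedResolvent, mul_assoc, Ring.inverse_mul_cancel _ (isUnit_one_sub_mul h), mul_one]

lemma one_sub_mul_perturbedResolvent (h : ‖E‖ * ‖R‖ < 1) :
    (1 - R * E) * perturbedResolvent E R = R := by
  rw [perturbedResolvent, ← mul_assoc, show (1 - R * E) * R = R * (1 - E * R) by noncomm_ring,
    mul_assoc, Ring.mul_inverse_cancel _ (isUnit_one_sub_mul h), mul_one]

lemma one_add_perturbedResolvent_mul (h : ‖E‖ * ‖R‖ < 1) :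
    (1 + perturbedResolvent E R * E) * (1 - R * E) = 1 := by
  have h1 := congrArg (· * E) (perturbedResolvent_mul_one_sub h)
  rw [show (1 + perturbedResolvent E R * E) * (1 - R * E)
    = 1 - R * E + perturbedResolvent E R * (1 - E * R) * E by noncomm_ring, h1]
  noncomm_ring

lemma one_add_perturbedResolvent_mul_self (h : ‖E‖ * ‖R‖ < 1) :
    (1 + perturbedResolvent E R * E) * R = perturbedResolvent E R := by
  have h1 := perturbedResolvent_mul_one_sub h
  rw [mul_sub, mul_one, sub_eq_iff_eq_add] at h1
  conv_rhs => rw [h1]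
  noncomm_ring

lemma norm_perturbedResolvent_le (h : ‖E‖ * ‖R‖ ≤ 1 / 2) :
    ‖perturbedResolvent E R‖ ≤ 2 * ‖R‖ := by
  have h1 := one_add_perturbedResolvent_mul_self (h.trans_lt (by norm_num))
  have h2 : ‖perturbedResolvent E R‖ ≤ ‖R‖ + ‖perturbedResolvent E R‖ * (‖E‖ * ‖R‖) := by
    conv_lhs => rw [← h1, add_mul, one_mul, mul_assoc]
    exact (norm_add_le _ _).trans (add_le_add_right ((norm_mul_le _ _).trans
      (mul_le_mul_of_nonneg_left (norm_mul_le _ _) (norm_nonneg _))) _)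
  nlinarith [norm_nonneg (perturbedResolvent E R)]

/-- Nonzero fixed points of `R C` correspond, for a finite rank perturbation `C` of `E`, to zeros of
a determinant. -/
lemma exists_fixed_iff_det_eq_zero (h : ‖E‖ * ‖R‖ < 1) {C : H →L[ℂ] H} {n : ℕ} {b : Fin n → H}
    {q : Fin n → H →L[ℂ] ℂ} (hC : ∀ x, C x = E x + ∑ i, q i x • b i) :
    (∃ W, W ≠ 0 ∧ R (C W) = W) ↔
      (1 - Matrix.of fun i j => q i (perturbedResolvent E R (b j))).det = 0 := by
  set S := perturbedResolvent E R with hS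
  have hq : ∀ (v : Fin n → ℂ) i, ((1 - Matrix.of fun i j => q i (S (b j))).mulVec v) i
      = v i - q i (S (∑ j, v j • b j)) := by
    intro v i
    rw [Matrix.sub_mulVec, Matrix.one_mulVec, Pi.sub_apply]
    simp [Matrix.mulVec, dotProduct, mul_comm]
  rw [← Matrix.exists_mulVec_eq_zero_iff]
  constructor
  · rintro ⟨W, hW, hfix⟩
    have hWS : W = S (∑ i, q i W • b i) := by
      have h1 : (1 - R * E) W = R (∑ i, q i W • b i) := by
        rw [hC, map_add] at hfix
        simp only [_root_.sub_apply, one_apply_eq_self,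
          mul_apply_eq_comp]
        exact sub_eq_iff_eq_add'.2 hfix.symm
      rw [hS, ← one_add_perturbedResolvent_mul_self h, mul_apply_eq_comp, ← h1,
        ← mul_apply_eq_comp, one_add_perturbedResolvent_mul h,
        one_apply_eq_self]
    refine ⟨fun i => q i W, fun h0 => hW ?_, funext fun i => ?_⟩
    · have h0' : ∀ i, q i W = 0 := congrFun h0
      rw [hWS]
      simp [h0']
    · rw [hq, ← hWS, sub_self, Pi.zero_apply]
  · rintro ⟨v, hv, hfix⟩
    have hv' : ∀ i, q i (S (∑ j, v j • b j)) = v i := fun i => by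
      have := congrFun hfix i
      rw [hq, Pi.zero_apply, sub_eq_zero] at this
      exact this.symm
    refine ⟨S (∑ j, v j • b j), fun h0 => hv (funext fun i => ?_), ?_⟩
    · rw [← hv', h0, map_zero, Pi.zero_apply]
    · have h1 := congrArg (fun L => L (∑ j, v j • b j)) (one_sub_mul_perturbedResolvent h)
      simp only [_root_.sub_apply, one_apply_eq_self,
        mul_apply_eq_comp] at h1
      rw [hC, map_add]
      simp only [hv']
      exact (sub_eq_iff_eq_add'.1 h1).symm

end Perturbation

/-- Strong continuity of the perturbed resolvent in a parameter. -/
lemma continuousOn_perturbedResolvent_apply {X : Type*} [TopologicalSpace X] {s : Set X}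
    {R : X → H →L[ℂ] H} {E : H →L[ℂ] H} {M : ℝ} (hM : ∀ p ∈ s, ‖R p‖ ≤ M)
    (hE : ∀ p ∈ s, ‖E‖ * ‖R p‖ ≤ 1 / 2) (hR : ∀ x, ContinuousOn (fun p => R p x) s) (x : H) :
    ContinuousOn (fun p => perturbedResolvent E (R p) x) s := by
  intro p₀ hp₀
  have hlt : ∀ p ∈ s, ‖E‖ * ‖R p‖ < 1 := fun p hp => (hE p hp).trans_lt (by norm_num)
  obtain ⟨y, hy⟩ : ∃ y, (1 - E * R p₀) y = x := ⟨Ring.inverse (1 - E * R p₀) x, by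
    rw [← mul_apply_eq_comp, Ring.mul_inverse_cancel _ (isUnit_one_sub_mul (hlt p₀ hp₀)),
      one_apply_eq_self]⟩
  have hkey : ∀ p ∈ s, perturbedResolvent E (R p) x
      = R p y + perturbedResolvent E (R p) (E (R p y - R p₀ y)) := by
    intro p hp
    have h1 := congrArg (fun L => L y) (perturbedResolvent_mul_one_sub (hlt p hp))
    rw [mul_apply_eq_comp] at h1
    calc perturbedResolvent E (R p) x
        = perturbedResolvent E (R p) ((1 - E * R p) y)
          + perturbedResolvent E (R p) (E (R p y - R p₀ y)) := by
            rw [← map_add, ← hy]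
            simp
      _ = _ := by rw [h1]
  have hRy := hR y p₀ hp₀
  have hzero : Tendsto (fun p => perturbedResolvent E (R p) (E (R p y - R p₀ y)))
      (nhdsWithin p₀ s) (nhds 0) := by
    have hb : Tendsto (fun p => 2 * M * ‖E (R p y - R p₀ y)‖) (nhdsWithin p₀ s) (nhds 0) := by
      have h := ((E.continuous.tendsto _).comp (hRy.sub_const (R p₀ y))).norm.const_mul (2 * M)
      simpa using h
    refine squeeze_zero_norm' ?_ hb
    filter_upwards [self_mem_nhdsWithin] with p hp
    exact ContinuousLinearMap.le_of_opNorm_le _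
      ((norm_perturbedResolvent_le (hE p hp)).trans (by linarith [hM p hp])) _
  have hlim := Tendsto.add hRy hzero
  rw [ContinuousWithinAt, hkey p₀ hp₀]
  simp only [sub_self, map_zero]
  refine hlim.congr' ?_
  filter_upwards [self_mem_nhdsWithin] with p hp
  exact (hkey p hp).symm

/-- A bounded pseudo-resolvent is holomorphic. -/
lemma differentiableOn_of_resolvent_identity {R : ℂ → H →L[ℂ] H} {U : Set ℂ} (hU : IsOpen U) {M : ℝ}
    (hM : ∀ z ∈ U, ‖R z‖ ≤ M)
    (hid : ∀ z ∈ U, ∀ w ∈ U, R w - R z = (z - w) • (R z * R w)) :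
    DifferentiableOn ℂ R U := by
  intro z hz
  have hcont : ContinuousAt R z := by
    rw [ContinuousAt, tendsto_iff_norm_sub_tendsto_zero]
    have hb : Tendsto (fun w => ‖z - w‖ * (M * M)) (nhds z) (nhds 0) := by
      have : Continuous (fun w : ℂ => ‖z - w‖ * (M * M)) := by fun_prop
      simpa using this.tendsto z
    refine squeeze_zero' (Eventually.of_forall fun _ => norm_nonneg _) ?_ hb
    filter_upwards [hU.mem_nhds hz] with w hw
    rw [hid z hz w hw, norm_smul]
    gcongr
    exact (norm_mul_le _ _).trans (mul_le_mul (hM z hz) (hM w hw) (norm_nonneg _)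
      ((norm_nonneg _).trans (hM z hz)))
  have hder : HasDerivAt R (-(R z * R z)) z := by
    rw [hasDerivAt_iff_tendsto_slope]
    have hlim : Tendsto (fun w => -(R z * R w)) (nhdsWithin z {z}ᶜ) (nhds (-(R z * R z))) :=
      ((tendsto_const_nhds.mul hcont).neg).mono_left nhdsWithin_le_nhds
    refine hlim.congr' ?_
    filter_upwards [self_mem_nhdsWithin, nhdsWithin_le_nhds (hU.mem_nhds hz)] with w hwz hw
    have hne : w - z ≠ 0 := sub_ne_zero.2 hwz
    rw [slope, vsub_eq_sub, hid z hz w hw, smul_smul, ← neg_sub w z, mul_neg, inv_mul_cancel₀ hne,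
      neg_one_smul]
  exact hder.differentiableAt.differentiableWithinAt

lemma DifferentiableOn.perturbedResolvent {R : ℂ → H →L[ℂ] H} {E : H →L[ℂ] H} {U : Set ℂ}
    (hR : DifferentiableOn ℂ R U) (hE : ∀ z ∈ U, ‖E‖ * ‖R z‖ < 1) :
    DifferentiableOn ℂ (fun z => perturbedResolvent E (R z)) U := by
  intro z hz
  have h1 : DifferentiableWithinAt ℂ (fun z => 1 - E * R z) U z :=
    (differentiableWithinAt_const _).sub ((differentiableWithinAt_const _).mul (hR z hz))
  have h2 := (differentiableAt_inverse (𝕜 := ℂ)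
    (isUnit_one_sub_mul (hE z hz))).comp_differentiableWithinAt z h1
  exact (hR z hz).mul h2

open MeasureTheory in
/-- Joint continuity of the Laplace transform in the parameter and in the spectral variable. -/
lemma continuousOn_laplaceOrbit {T : ℝ → ℝ → H →L[ℂ] H}
    (hT : ∀ ν : ℝ, 0 ≤ ν → IsContractionSemigroup (T ν))
    (hcont : ∀ τ : ℝ, 0 ≤ τ → ∀ W : H, ContinuousOn (fun ν => T ν τ W) (Ici 0))
    {σ : ℝ} (hσ : 0 < σ) (x : H) :
    ContinuousOn (fun p : ℝ × ℂ => laplaceOrbit (T p.1) p.2 x) (Ici 0 ×ˢ {z | σ < z.re}) := by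
  refine continuousOn_of_dominated (bound := fun τ => Real.exp (-σ * τ) * ‖x‖)
    (fun p hp => (hT p.1 hp.1).aestronglyMeasurable_integrand p.2 x) (fun p hp => ?_)
    ((integrableOn_exp_mul_Ioi (by linarith) 0).mul_const ‖x‖) ?_
  · filter_upwards [ae_restrict_mem measurableSet_Ioi] with τ hτ
    have hτ' : 0 < τ := hτ
    have hp2 : σ < p.2.re := hp.2
    refine ((hT p.1 hp.1).norm_integrand_le p.2 x hτ'.le).trans ?_
    gcongr
  · filter_upwards [ae_restrict_mem measurableSet_Ioi] with τ hτ
    refine ContinuousOn.smul (by fun_prop) ?_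
    exact (hcont τ (le_of_lt hτ) x).comp continuousOn_fst fun p hp => hp.1

/-- The resolvents of a parametrised family of contraction semigroups, as bounded operators. -/
lemma exists_resolvent_family {A : ℝ → H → H} {D : ℝ → Set H} {T : ℝ → ℝ → H →L[ℂ] H}
    (hgen : ∀ ν : ℝ, 0 ≤ ν → Generates (A ν) (D ν) (T ν) ∧ IsContractionSemigroup (T ν)) :
    ∃ R : ℝ → ℂ → H →L[ℂ] H, ∀ ν, 0 ≤ ν →
      (∀ z : ℂ, 0 < z.re → ‖R ν z‖ ≤ 1 / z.re ∧
        (∀ x, R ν z x = laplaceOrbit (T ν) z x) ∧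
        (∀ x, R ν z x ∈ D ν ∧ A ν (R ν z x) = z • R ν z x - x) ∧
        ∀ x ∈ D ν, R ν z (z • x - A ν x) = x) ∧
      ∀ z : ℂ, 0 < z.re → ∀ w : ℂ, 0 < w.re → R ν w - R ν z = (z - w) • (R ν z * R ν w) := by
  have h : ∀ ν, ∃ R : ℂ → H →L[ℂ] H, 0 ≤ ν → ∀ z : ℂ, 0 < z.re →
      ‖R z‖ ≤ 1 / z.re ∧ ∀ x, R z x = laplaceOrbit (T ν) z x := by
    intro ν
    by_cases hν : 0 ≤ ν
    · obtain ⟨R, hR⟩ := (hgen ν hν).2.exists_laplaceOrbit_eq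
      exact ⟨R, fun _ => hR⟩
    · exact ⟨0, fun h => absurd h hν⟩
  choose R hR using h
  refine ⟨R, fun ν hν => ?_⟩
  obtain ⟨hG, hT⟩ := hgen ν hν
  have hmem : ∀ z : ℂ, 0 < z.re → ∀ x, R ν z x ∈ D ν ∧ A ν (R ν z x) = z • R ν z x - x := by
    intro z hz x
    rw [(hR ν hν z hz).2]
    exact hG.resolvent_mem_and_apply hT hz x
  have hinv : ∀ z : ℂ, 0 < z.re → ∀ x ∈ D ν, R ν z (z • x - A ν x) = x := by
    intro z hz x hx
    rw [(hR ν hν z hz).2]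
    exact hG.laplaceOrbit_sub hT hz hx
  refine ⟨fun z hz => ⟨(hR ν hν z hz).1, (hR ν hν z hz).2, hmem z hz, hinv z hz⟩,
    fun z hz w hw => ?_⟩
  ext x
  obtain ⟨hD, hA⟩ := hmem w hw x
  have h := hinv z hz _ hD
  rw [hA, show z • R ν w x - (w • R ν w x - x) = (z - w) • R ν w x + x by
    rw [sub_smul]; abel, map_add, map_smul] at h
  simp only [_root_.sub_apply, _root_.smul_apply, mul_apply_eq_comp]
  exact sub_eq_iff_eq_add.2 h.symm

/-- Vishik's spectral perturbation argument: an unstable eigenvalue of `L₀ = A₀ + C`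
persists, up to halving its real part, for `L_ν = A_ν + C` with small `ν > 0`. -/
theorem vishik_spectral_perturbation
    (A : ℝ → H → H) (D : ℝ → Set H) (T : ℝ → ℝ → H →L[ℂ] H)
    (hgen : ∀ ν : ℝ, 0 ≤ ν → Generates (A ν) (D ν) (T ν) ∧ IsContractionSemigroup (T ν))
    (hcont : ∀ τ : ℝ, 0 ≤ τ → ∀ W : H, ContinuousOn (fun ν => T ν τ W) (Set.Ici 0))
    (C : H →L[ℂ] H) (hC : IsCompactOperator (fun x => C x))
    (lam0 : ℂ) (hlam0 : 0 < lam0.re) (W0 : H) (hW0 : W0 ∈ D 0) (hW0ne : W0 ≠ 0)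
    (heig0 : A 0 W0 + C W0 = lam0 • W0) :
    ∀ ν0 : ℝ, 0 < ν0 →
      ∃ ν : ℝ, 0 < ν ∧ ν ≤ ν0 ∧
        ∃ lam : ℂ, lam0.re / 2 < lam.re ∧
          ∃ W : H, W ∈ D ν ∧ W ≠ 0 ∧ A ν W + C W = lam • W := by
  intro ν₀ hν₀
  obtain ⟨R, hR⟩ := exists_resolvent_family hgen
  set σ : ℝ := lam0.re / 2 with hσdef
  have hσ : 0 < σ := by positivity
  set U : Set ℂ := {z | σ < z.re} with hUdef
  have hpos : ∀ z ∈ U, 0 < z.re := fun z hz => hσ.trans hz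
  have hUo : IsOpen U := isOpen_lt continuous_const Complex.continuous_re
  have hUc : IsPreconnected U := (convex_halfSpace_re_gt σ).isPreconnected
  have hRnorm : ∀ ν, 0 ≤ ν → ∀ z ∈ U, ‖R ν z‖ ≤ 1 / σ := fun ν hν z hz =>
    ((hR ν hν).1 z (hpos z hz)).1.trans (one_div_le_one_div_of_le hσ (le_of_lt hz))
  obtain ⟨n, b, q, E, hE, hCE⟩ := hC.exists_finiteRank_norm_sub_le (ε := σ / 2) (by positivity)
  have hER : ∀ ν, 0 ≤ ν → ∀ z ∈ U, ‖E‖ * ‖R ν z‖ ≤ 1 / 2 := fun ν hν z hz =>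
    (mul_le_mul hE (hRnorm ν hν z hz) (norm_nonneg _) (by positivity)).trans_eq (by field_simp)
  have hER' : ∀ ν, 0 ≤ ν → ∀ z ∈ U, ‖E‖ * ‖R ν z‖ < 1 := fun ν hν z hz =>
    (hER ν hν z hz).trans_lt (by norm_num)
  let d : ℝ → ℂ → ℂ := fun ν z =>
    (1 - Matrix.of fun i j => q i (perturbedResolvent E (R ν z) (b j))).det
  have hd : ∀ ν, 0 ≤ ν → ∀ z ∈ U, ((∃ W, W ≠ 0 ∧ R ν z (C W) = W) ↔ d ν z = 0) :=
    fun ν hν z hz => exists_fixed_iff_det_eq_zero (hER' ν hν z hz) hCE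
  have hdcont : ContinuousOn (fun p : ℝ × ℂ => d p.1 p.2) (Ici 0 ×ˢ U) := by
    have hS : ∀ x, ContinuousOn (fun p : ℝ × ℂ => perturbedResolvent E (R p.1 p.2) x)
        (Ici 0 ×ˢ U) := by
      refine continuousOn_perturbedResolvent_apply (M := 1 / σ)
        (fun p hp => hRnorm p.1 hp.1 p.2 hp.2) (fun p hp => hER p.1 hp.1 p.2 hp.2) fun x => ?_
      exact (continuousOn_laplaceOrbit (fun ν hν => (hgen ν hν).2) hcont hσ x).congr
        fun p hp => ((hR p.1 hp.1).1 p.2 (hpos p.2 hp.2)).2.1 x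
    simp only [d, Matrix.det_apply, Matrix.sub_apply, Matrix.of_apply]
    refine continuousOn_finsetSum _ fun τ _ => ContinuousOn.const_smul (continuousOn_finsetProd _
      fun i _ => continuousOn_const.sub ((q _).continuous.comp_continuousOn (hS _))) _
  have hddiff : ∀ ν, 0 ≤ ν → DifferentiableOn ℂ (d ν) U := by
    intro ν hν
    have hS := (differentiableOn_of_resolvent_identity hUo (hRnorm ν hν)
      fun z hz w hw => (hR ν hν).2 z (hpos z hz) w (hpos w hw)).perturbedResolvent (hER' ν hν)
    simp only [d, Matrix.det_apply, Matrix.sub_apply, Matrix.of_apply]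
    refine DifferentiableOn.fun_sum fun τ _ => DifferentiableOn.const_smul
      (DifferentiableOn.fun_finsetProd fun i _ => (differentiableOn_const _).sub
        ((q _).differentiable.comp_differentiableOn (hS.clm_apply (differentiableOn_const _)))) _
  have hlamU : lam0 ∈ U := by
    change lam0.re / 2 < lam0.re
    linarith
  have hd₀ : d 0 lam0 = 0 := by
    refine (hd 0 le_rfl lam0 hlamU).1 ⟨W0, hW0ne, ?_⟩
    rw [← eq_sub_iff_add_eq'] at heig0
    rw [heig0]
    exact ((hR 0 le_rfl).1 lam0 hlam0).2.2.2 W0 hW0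
  let z₁ : ℂ := ((σ + ‖C‖ + 1 : ℝ) : ℂ)
  have hz₁re : z₁.re = σ + ‖C‖ + 1 := Complex.ofReal_re _
  have hz₁U : z₁ ∈ U := by
    change σ < z₁.re
    linarith [norm_nonneg C]
  have hd₁ : d 0 z₁ ≠ 0 := by
    rw [Ne, ← hd 0 le_rfl z₁ hz₁U]
    rintro ⟨W, hW, hfix⟩
    have hWpos : 0 < ‖W‖ := norm_pos_iff.2 hW
    have h1 : ‖W‖ ≤ 1 / z₁.re * (‖C‖ * ‖W‖) := by
      conv_lhs => rw [← hfix]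
      exact ((R 0 z₁).le_of_opNorm_le ((hR 0 le_rfl).1 z₁ (hpos z₁ hz₁U)).1 _).trans
        (mul_le_mul_of_nonneg_left (C.le_opNorm W) (one_div_nonneg.2 (hpos z₁ hz₁U).le))
    rw [one_div_mul_eq_div, le_div_iff₀ (hpos z₁ hz₁U), hz₁re] at h1
    nlinarith
  obtain ⟨ν, hν, hνle, z, hz, hzero⟩ :=
    exists_zero_of_continuousOn_family hUo hUc hdcont hddiff hlamU hz₁U hd₀ hd₁ hν₀
  obtain ⟨W, hW, hfix⟩ := (hd ν hν.le z hz).2 hzero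
  obtain ⟨hWD, hWA⟩ := ((hR ν hν.le).1 z (hpos z hz)).2.2.1 (C W)
  rw [hfix] at hWD hWA
  exact ⟨ν, hν, hνle, z, hz, W, hWD, hW, by rw [hWA, sub_add_cancel]⟩
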